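/- Let X be a complex Banach space and let k ∈ {1, 2}. Then UC(ℝ,X) ∩ g^k·UC(ℝ,X) = C₀(ℝ,X); that is, a function f : ℝ → X is uniformly continuous and of the form f = g^k·v for some uniformly continuous v : ℝ → X if and only if f is continuous and ‖f(t)‖ → 0 as |t| → ∞. -/

import Mathlib

open Filter

noncomputable def g (t : ℝ) : ℂ := Complex.exp (Complex.I * (t : ℂ) ^ 2)

lemma aux_pt (t c : ℝ) (hc : 0 ≤ c) : ∃ s : ℝ, s ^ 2 = t ^ 2 + c ∧ |s - t| * |t| ≤ c := by
  have h0 : 0 ≤ t ^ 2 + c := by positivity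
  have hs := Real.sq_sqrt h0
  have hn := Real.sqrt_nonneg (t ^ 2 + c)
  have hge : |t| ≤ Real.sqrt (t ^ 2 + c) := Real.abs_le_sqrt (by linarith)
  generalize Real.sqrt (t ^ 2 + c) = r at *
  rcases le_total 0 t with h | h
  · rw [abs_of_nonneg h] at hge
    refine ⟨r, hs, ?_⟩
    rw [abs_of_nonneg h, abs_of_nonneg (by linarith)]
    nlinarith
  · rw [abs_of_nonpos h] at hge
    refine ⟨-r, by rw [neg_sq]; exact hs, ?_⟩
    rw [abs_of_nonpos h, abs_of_nonpos (by linarith)]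
    nlinarith

lemma g_norm (t : ℝ) : ‖g t‖ = 1 := by
  have : g t = Complex.exp (((t ^ 2 : ℝ) : ℂ) * Complex.I) := by
    unfold g; push_cast; ring_nf
  rw [this, Complex.norm_exp_ofReal_mul_I]

lemma g_cont : Continuous g := by
  unfold g; fun_prop

lemma g_flip (k : ℕ) (hk : k ≠ 0) (s t : ℝ) (h : s ^ 2 = t ^ 2 + Real.pi / k) :
    g s ^ k = - g t ^ k := by
  have hk' : (k : ℂ) ≠ 0 := by exact_mod_cast hk
  have h' : (s : ℂ) ^ 2 = (t : ℂ) ^ 2 + Real.pi / k := by exact_mod_cast h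
  unfold g
  rw [← Complex.exp_nat_mul, ← Complex.exp_nat_mul, h']
  have : (k : ℂ) * (Complex.I * ((t : ℂ) ^ 2 + Real.pi / k))
      = k * (Complex.I * (t : ℂ) ^ 2) + Real.pi * Complex.I := by
    field_simp
  rw [this, Complex.exp_add, Complex.exp_pi_mul_I]
  ring

theorem stmt3 (X : Type*) [NormedAddCommGroup X] [NormedSpace ℂ X] [CompleteSpace X]
    (k : ℕ) (hk : k = 1 ∨ k = 2) (f : ℝ → X) :
    (UniformContinuous f ∧
        ∃ v : ℝ → X, UniformContinuous v ∧ ∀ t, f t = (g t) ^ k • v t) ↔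
      (Continuous f ∧ Tendsto (fun t => ‖f t‖) (cocompact ℝ) (nhds 0)) := by
  have hk0 : k ≠ 0 := by omega
  have hgk : ∀ t, ‖g t ^ k‖ = 1 := fun t => by rw [norm_pow, g_norm, one_pow]
  have hg0 : ∀ t, g t ^ k ≠ 0 := fun t => by
    rw [← norm_ne_zero_iff, hgk]; exact one_ne_zero
  constructor
  · rintro ⟨hf, v, hv, hfv⟩
    refine ⟨hf.continuous, ?_⟩
    rw [Metric.tendsto_nhds]
    intro ε hε
    obtain ⟨d1, hd1, h1⟩ := Metric.uniformContinuous_iff.1 hf ε hε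
    obtain ⟨d2, hd2, h2⟩ := Metric.uniformContinuous_iff.1 hv ε hε
    set d := min d1 d2 with hd
    have hdp : 0 < d := lt_min hd1 hd2
    have hc : 0 < Real.pi / k := by
      have : (0 : ℝ) < k := by exact_mod_cast Nat.pos_of_ne_zero hk0
      have := Real.pi_pos
      positivity
    have hlarge : ∀ᶠ t : ℝ in cocompact ℝ, (Real.pi / k) / d < ‖t‖ :=
      (tendsto_norm_cocompact_atTop (E := ℝ)).eventually_gt_atTop _
    filter_upwards [hlarge] with t ht
    obtain ⟨s, hs, hst⟩ := aux_pt t _ hc.le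
    rw [Real.norm_eq_abs, div_lt_iff₀ hdp] at ht
    have hlt : dist s t < d := by
      rw [Real.dist_eq]
      by_contra! hcon
      nlinarith [abs_nonneg t]
    have a1 := h1 (hlt.trans_le (min_le_left _ _))
    have a2 := h2 (hlt.trans_le (min_le_right _ _))
    rw [dist_eq_norm] at a1 a2
    have e : f s - f t = -(g t ^ k • (v s - v t)) - (2 : ℂ) • f t := by
      rw [hfv s, hfv t, g_flip k hk0 s t hs]
      module
    have e2 : (2 : ℂ) • f t = -(g t ^ k • (v s - v t)) - (f s - f t) := by
      rw [e]; abel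
    have n := norm_sub_le (-(g t ^ k • (v s - v t))) (f s - f t)
    rw [← e2, norm_neg, norm_smul, norm_smul, hgk] at n
    simp only [Complex.norm_ofNat, one_mul] at n
    rw [dist_zero_right, norm_norm]
    linarith
  · rintro ⟨hc, ht⟩
    have key : ∀ u : ℝ → X, Continuous u → (∀ t, ‖u t‖ = ‖f t‖) → UniformContinuous u := by
      intro u hu hn
      refine hu.uniformContinuous_of_tendsto_cocompact (x := 0) ?_
      rw [tendsto_zero_iff_norm_tendsto_zero]
      simpa only [hn] using ht
    refine ⟨key f hc fun _ => rfl, fun t => (g t ^ k)⁻¹ • f t, key _ ?_ ?_, ?_⟩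
    · exact ((g_cont.pow k).inv₀ hg0).smul hc
    · intro t
      rw [norm_smul, norm_inv, hgk, inv_one, one_mul]
    · intro t
      rw [smul_inv_smul₀ (hg0 t)]
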